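/- Let p be a prime and let G be a finite p-group of order pⁿ with |γ₂(G)| = p^m, and let {x₁, …, x_d} be any minimal generating set of G. Then |Aut_c(G)| ≤ ∏_{i=1}^{d} |x_i^G| ≤ p^{md} ≤ p^{m(n−m)}. Moreover, |Aut_c(G)| = p^{m(n−m)} if and only if G is either an abelian p-group or a non-abelian Camina special p-group. -/

import Mathlib

/-- The subgroup of `MulAut G` consisting of class preserving automorphisms. -/
def classPreservingAuts (G : Type*) [Group G] : Subgroup (MulAut G) where
  carrier := {α | ∀ x : G, IsConj x (α x)}
  one_mem' := fun x => by simpa using IsConj.refl x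
  mul_mem' := fun {a b} ha hb x => (hb x).trans (ha (b x))
  inv_mem' := fun {a} ha x => by
    have h := (ha (a⁻¹ x)).symm
    simpa using h

section

open Subgroup
open scoped commutatorElement

section PGroup

variable {p : ℕ} {G : Type*} [Group G] [Finite G]

theorem IsPGroup.mul_card_le_card_of_lt (hp : p.Prime) (hG : IsPGroup p G) {K L : Subgroup G}
    (h : K < L) : p * Nat.card K ≤ Nat.card L := by
  have := Fact.mk hp
  obtain ⟨i, hi⟩ := IsPGroup.iff_card.mp (hG.to_subgroup K)
  obtain ⟨j, hj⟩ := IsPGroup.iff_card.mp (hG.to_subgroup L)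
  have hlt : Nat.card K < Nat.card L :=
    Set.ncard_lt_ncard (SetLike.coe_ssubset_coe.mpr h) (Set.toFinite _)
  rw [hi, hj] at hlt ⊢
  have := (Nat.pow_lt_pow_iff_right hp.one_lt).mp hlt
  calc p * p ^ i = p ^ (i + 1) := by ring
    _ ≤ p ^ j := Nat.pow_le_pow_right hp.pos this

/-- Below a subgroup `L` of a finite `p`-group, any subgroup `K` can be completed to `L` by
adjoining at most `log_p |L : K|` elements. -/
theorem IsPGroup.exists_finset_closure_sup_eq (hp : p.Prime) (hG : IsPGroup p G)
    {K L : Subgroup G} (h : K ≤ L) :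
    ∃ T : Finset G, closure (T : Set G) ⊔ K = L ∧ p ^ T.card * Nat.card K ≤ Nat.card L := by
  classical
  induction K using WellFoundedGT.induction with
  | ind K ih =>
    rcases h.eq_or_lt with rfl | hlt
    · exact ⟨∅, by simp, by simp⟩
    · obtain ⟨x, hxL, hxK⟩ := SetLike.exists_of_lt hlt
      have hlt' : K < zpowers x ⊔ K :=
        lt_of_le_of_ne le_sup_right fun e => hxK (e ▸ mem_sup_left (mem_zpowers x))
      obtain ⟨T, hT, hc⟩ := ih _ hlt' (sup_le (zpowers_le.mpr hxL) h)
      refine ⟨insert x T, ?_, ?_⟩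
      · rw [Finset.coe_insert, Set.insert_eq, Subgroup.closure_union, ← zpowers_eq_closure,
          sup_comm (zpowers x), sup_assoc, hT]
      · calc p ^ (insert x T).card * Nat.card K ≤ p ^ (T.card + 1) * Nat.card K :=
              Nat.mul_le_mul_right _ (Nat.pow_le_pow_right hp.pos (Finset.card_insert_le _ _))
          _ = p ^ T.card * (p * Nat.card K) := by ring
          _ ≤ p ^ T.card * Nat.card (zpowers x ⊔ K : Subgroup G) :=
              Nat.mul_le_mul_left _ (hG.mul_card_le_card_of_lt hp hlt')
          _ ≤ _ := hc

theorem IsPGroup.commutator_le_frattini (hp : p.Prime) (hG : IsPGroup p G) :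
    commutator G ≤ frattini G := by
  have := Fact.mk hp
  have := hG.isNilpotent
  refine le_iInf₂ fun M hM => ?_
  have : M.Normal :=
    NormalizerCondition.normal_of_coatom M Group.normalizerCondition_of_isNilpotent hM
  have : Nontrivial (G ⧸ M) := QuotientGroup.nontrivial_iff.mpr hM.1
  have hlt := (hG.to_quotient M).bot_lt_center
  have hlt' : M < (center (G ⧸ M)).comap (QuotientGroup.mk' M) := by
    have := (comap_lt_comap_of_surjective (QuotientGroup.mk'_surjective M)).mpr hlt
    rwa [MonoidHom.comap_bot, QuotientGroup.ker_mk'] at this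
  have htop := hM.2 _ hlt'
  rw [commutator_def, commutator_le]
  intro a _ b _
  have ha : a ∈ (center (G ⧸ M)).comap (QuotientGroup.mk' M) := htop ▸ mem_top a
  rw [← QuotientGroup.eq_one_iff]
  have := mem_center_iff.mp (mem_comap.mp ha) (b : G ⧸ M)
  change ((⁅(a : G ⧸ M), (b : G ⧸ M)⁆ : G ⧸ M)) = 1
  rw [commutatorElement_eq_one_iff_mul_comm]
  exact this.symm

theorem IsPGroup.eq_top_of_sup_commutator (hp : p.Prime) (hG : IsPGroup p G) {K : Subgroup G}
    (h : K ⊔ commutator G = ⊤) : K = ⊤ :=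
  frattini_nongenerating (top_le_iff.mp (h ▸ sup_le_sup_left (hG.commutator_le_frattini hp) K))

/-- An irredundant generating set of a finite `p`-group has at most `log_p |G : γ₂(G)|` elements. -/
theorem IsPGroup.pow_card_mul_card_commutator_le (hp : p.Prime) (hG : IsPGroup p G) {S : Finset G}
    (hgen : closure (S : Set G) = ⊤)
    (hmin : ∀ T : Finset G, T ⊂ S → closure (T : Set G) ≠ ⊤) :
    p ^ S.card * Nat.card (commutator G) ≤ Nat.card G := by
  classical
  have key : ∀ T : Finset G, T ⊆ S → p ^ T.card * Nat.card (commutator G) ≤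
      Nat.card (closure (T : Set G) ⊔ commutator G : Subgroup G) := by
    intro T
    induction T using Finset.induction_on with
    | empty => simp
    | insert x T hx ih =>
      intro hTS
      have hTS' := (Finset.subset_insert x T).trans hTS
      have hlt : closure (T : Set G) ⊔ commutator G <
          closure ((insert x T : Finset G) : Set G) ⊔ commutator G := by
        refine lt_of_le_of_ne (sup_le_sup_right (Subgroup.closure_mono (by simp)) _) fun e => ?_
        have hxS : x ∈ S := hTS (Finset.mem_insert_self x T)
        refine hmin (S.erase x) (Finset.erase_ssubset hxS) (hG.eq_top_of_sup_commutator hp ?_)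
        rw [eq_top_iff, ← hgen, closure_le]
        intro y hy
        have hT : closure (T : Set G) ≤ closure ((S.erase x : Finset G) : Set G) :=
          Subgroup.closure_mono (Finset.coe_subset.mpr
            (Finset.subset_erase.mpr ⟨hTS', hx⟩))
        by_cases hyx : y = x
        · subst hyx
          refine sup_le_sup_right hT _ ?_
          rw [e]
          exact mem_sup_left (subset_closure (by simp))
        · exact mem_sup_left (subset_closure (by simpa [hyx] using hy))
      calc p ^ (insert x T).card * Nat.card (commutator G)
          = p * (p ^ T.card * Nat.card (commutator G)) := by
            rw [Finset.card_insert_of_notMem hx]; ring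
        _ ≤ p * Nat.card (closure (T : Set G) ⊔ commutator G : Subgroup G) :=
            Nat.mul_le_mul_left _ (ih hTS')
        _ ≤ _ := hG.mul_card_le_card_of_lt hp hlt
  have := key S subset_rfl
  rwa [hgen, top_sup_eq, card_top] at this

end PGroup

theorem Subgroup.card_zpowers_sup_le {p : ℕ} {G : Type*} [Group G] (hp : 0 < p)
    {N : Subgroup G} [N.Normal] [Finite N] {x : G}
    (hx : x ^ p ∈ N) : Nat.card (zpowers x ⊔ N : Subgroup G) ≤ p * Nat.card N := by
  have : NeZero p := ⟨hp.ne'⟩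
  rw [← Nat.card_fin p, ← Nat.card_prod]
  refine Nat.card_le_card_of_surjective (fun q : Fin p × N =>
    (⟨x ^ (q.1 : ℕ) * q.2, mul_mem (mem_sup_left (npow_mem_zpowers x q.1))
      (mem_sup_right q.2.2)⟩ : (zpowers x ⊔ N : Subgroup G))) ?_
  rintro ⟨y, hy⟩
  obtain ⟨_, ⟨k, rfl⟩, u, hu, rfl⟩ := mem_sup_of_normal_right.mp hy
  have hk0 : 0 ≤ k % (p : ℤ) := Int.emod_nonneg _ (by exact_mod_cast hp.ne')
  have hk1 : k % (p : ℤ) < p := Int.emod_lt_of_pos _ (by exact_mod_cast hp)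
  refine ⟨⟨⟨(k % (p : ℤ)).toNat, by omega⟩, ⟨(x ^ p) ^ (k / (p : ℤ)) * u,
    mul_mem (zpow_mem hx _) hu⟩⟩, ?_⟩
  ext
  simp only
  rw [← zpow_natCast, Int.toNat_of_nonneg hk0, ← mul_assoc, ← zpow_natCast x p, ← zpow_mul,
    ← zpow_add, Int.emod_add_mul_ediv]

section CaminaCore

variable {p : ℕ} {G : Type*} [Group G]

theorem commutatorElement_eq_commutatorElement_left_iff {x y z : G} :
    ⁅y, x⁆ = ⁅z, x⁆ ↔ y⁻¹ * z ∈ centralizer {x} := by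
  rw [mem_centralizer_singleton_iff, commutatorElement_def, commutatorElement_def,
    mul_left_inj]
  constructor <;> intro h
  · rw [mul_inv_eq_iff_eq_mul] at h
    have h' : z * x = y * x * (y⁻¹ * z) := by rw [h]; group
    rw [mul_assoc, h']
    group
  · rw [mul_inv_eq_iff_eq_mul]
    have h' : z * x = y * x * (y⁻¹ * z) := by
      rw [mul_assoc, ← h]; group
    rw [mul_assoc, mul_assoc, ← mul_assoc z x, h']
    group

theorem card_setOf_commutatorElement_mem {x : G} {W : Subgroup G}
    (hW : ∀ u ∈ W, ∃ y : G, ⁅y, x⁆ = u) :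
    Nat.card {y : G // ⁅y, x⁆ ∈ W} = Nat.card W * Nat.card (centralizer {x}) := by
  choose! s hs using hW
  rw [← Nat.card_prod]
  refine Nat.card_congr
    { toFun := fun y => (⟨⁅y.1, x⁆, y.2⟩, ⟨(s ⁅y.1, x⁆)⁻¹ * y.1,
        commutatorElement_eq_commutatorElement_left_iff.mp (hs _ y.2)⟩)
      invFun := fun q => ⟨s q.1 * q.2, ?_⟩
      left_inv := fun y => by simp
      right_inv := ?_ }
  · have := commutatorElement_eq_commutatorElement_left_iff (x := x) (y := s q.1)
      (z := s q.1 * q.2)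
    rw [← this.mpr (by simp), hs _ q.1.2]
    exact q.1.2
  · rintro ⟨⟨u, hu⟩, ⟨c, hc⟩⟩
    have := commutatorElement_eq_commutatorElement_left_iff (x := x) (y := s u)
      (z := s u * c)
    have h : ⁅s u * c, x⁆ = u := by rw [← this.mpr (by simpa using hc), hs _ hu]
    simp [h]

theorem card_setOf_commutatorElement_mem_mul [Finite G] {x : G} {W : Subgroup G}
    (hW : W ≤ commutator G) (hx : ∀ u ∈ commutator G, ∃ y : G, ⁅y, x⁆ = u) :
    Nat.card {y : G // ⁅y, x⁆ ∈ W} * Nat.card (commutator G) = Nat.card W * Nat.card G := by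
  have h1 := card_setOf_commutatorElement_mem (fun u hu => hx u (hW hu))
  have h2 := card_setOf_commutatorElement_mem hx
  have h3 : ∀ y : G, ⁅y, x⁆ ∈ commutator G :=
    fun y => commutator_mem_commutator (mem_top y) (mem_top x)
  rw [Nat.card_congr (Equiv.subtypeUnivEquiv h3)] at h2
  rw [h1, h2]
  ring

theorem commute_of_isConj_commutatorElement {x y : G} (hz : ⁅x, y⁆ ∈ center G)
    (h : ∀ a ∈ commutator G, ∀ b ∈ commutator G, IsConj ⁅x, y⁆ ⁅x * a, y * b⁆) :
    x ∈ centralizer (commutator G : Set G) ∧ y ∈ centralizer (commutator G : Set G) := by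
  have key : ∀ a ∈ commutator G, ∀ b ∈ commutator G, ⁅x * a, y * b⁆ = ⁅x, y⁆ := by
    intro a ha b hb
    obtain ⟨c, hc⟩ := isConj_iff.mp (h a ha b hb)
    rw [← hc, mem_center_iff.mp hz c, mul_inv_cancel_right]
  constructor <;> rw [mem_centralizer_iff] <;> intro a ha
  · have := key 1 (one_mem _) a ha
    rw [mul_one, commutatorElement_mul_right_eq_mul_conj, mul_assoc, mul_assoc,
      mul_eq_left, ← mul_assoc, conj_eq_one_iff, commutatorElement_eq_one_iff_mul_comm] at this
    exact this.symm
  · have := key a ha 1 (one_mem _)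
    rw [mul_one, commutatorElement_mul_left_eq_conj_mul, mul_eq_right, conj_eq_one_iff,
      commutatorElement_eq_one_iff_mul_comm] at this
    exact this

theorem IsPGroup.card_mul_le_card_commutator_sq [Finite G] (hp : p.Prime) (hG : IsPGroup p G)
    {N : Subgroup G} (hNc : N ≤ center G) (hNG : N ≤ commutator G) (hN : Nat.card N = p)
    (hcomm : ∀ u ∈ commutator G, ∀ g, ⁅u, g⁆ ∈ N)
    (hC : centralizer (commutator G : Set G) ≤ commutator G) :
    Nat.card G * p ≤ Nat.card (commutator G) * Nat.card (commutator G) := by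
  obtain ⟨T, hT, hcard⟩ := hG.exists_finset_closure_sup_eq hp hNG
  have hTG : ∀ t ∈ T, t ∈ commutator G := fun t ht => by
    rw [← hT]; exact mem_sup_left (subset_closure ht)
  have hinj : Function.Injective (fun (w : G ⧸ commutator G) (t : T) =>
      (⟨⁅(t : G), w.out⁆, hcomm t (hTG t t.2) _⟩ : N)) := by
    intro v w hvw
    rw [← v.out_eq', ← w.out_eq']
    refine QuotientGroup.eq.mpr (hC ?_)
    have hle : closure (T : Set G) ⊔ N ≤ centralizer {v.out⁻¹ * w.out} := by
      refine sup_le ((closure_le _).mpr fun t ht => ?_) (hNc.trans (center_le_centralizer _))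
      have ht' : ⁅t, v.out⁆ = ⁅t, w.out⁆ := congrArg Subtype.val (congrFun hvw ⟨t, ht⟩)
      rw [← commutatorElement_inv v.out, ← commutatorElement_inv w.out, inv_inj] at ht'
      have := commutatorElement_eq_commutatorElement_left_iff.mp ht'
      rw [mem_centralizer_singleton_iff] at this
      exact mem_centralizer_singleton_iff.mpr this.symm
    rw [hT] at hle
    rw [mem_centralizer_iff]
    exact fun u hu => mem_centralizer_singleton_iff.mp (hle hu)
  have hle := Nat.card_le_card_of_injective _ hinj
  rw [Nat.card_fun, hN, Nat.card_eq_fintype_card (α := T), Fintype.card_coe] at hle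
  have hidx := (commutator G).card_eq_card_quotient_mul_card_subgroup
  rw [hN] at hcard
  calc Nat.card G * p = Nat.card (G ⧸ commutator G) * Nat.card (commutator G) * p := by rw [hidx]
    _ ≤ p ^ T.card * Nat.card (commutator G) * p := by gcongr
    _ = (p ^ T.card * p) * Nat.card (commutator G) := by ring
    _ ≤ _ := Nat.mul_le_mul_right _ hcard

theorem IsPGroup.commutator_le_center_of_card_eq [Finite G] (hp : p.Prime) (hG : IsPGroup p G)
    (hpow : ∀ x : G, x ^ p ∈ commutator G)
    (hcam : ∀ x ∉ commutator G, ∀ u ∈ commutator G, ∃ y : G, ⁅y, x⁆ = u)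
    (hconj : ∀ x ∉ commutator G, ∀ y ∉ zpowers x ⊔ commutator G,
      ∀ a ∈ commutator G, ∀ b ∈ commutator G, IsConj ⁅x, y⁆ ⁅x * a, y * b⁆)
    {N : Subgroup G} (hNc : N ≤ center G) (hNG : N ≤ commutator G) (hN : Nat.card N = p)
    (hcomm : ∀ u ∈ commutator G, ∀ g, ⁅u, g⁆ ∈ N) : commutator G ≤ center G := by
  have hGC : commutator G ≤ centralizer (commutator G : Set G) := by
    have h1 : ⁅⁅commutator G, (⊤ : Subgroup G)⁆, (⊤ : Subgroup G)⁆ = ⊥ := by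
      rw [commutator_top_right_eq_bot_iff_le_center]
      exact (commutator_le.mpr fun u hu g _ => hcomm u hu g).trans hNc
    have h2 : ⁅⁅(⊤ : Subgroup G), commutator G⁆, (⊤ : Subgroup G)⁆ = ⊥ := by
      rwa [commutator_comm ⊤ (commutator G)]
    exact commutator_eq_bot_iff_le_centralizer.mp (commutator_commutator_eq_bot_of_rotate h2 h1)
  by_contra hnc
  obtain ⟨x, hxC⟩ : ∃ x, x ∉ centralizer (commutator G : Set G) := by
    by_contra! h
    exact hnc fun u hu => mem_center_iff.mpr fun g => (mem_centralizer_iff.mp (h g) u hu).symm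
  have hx : x ∉ commutator G := fun h => hxC (hGC h)
  let K (x : G) : Set G := {y | ⁅y, x⁆ ∈ N}
  have hKcard : ∀ z ∉ commutator G, (K z).ncard * Nat.card (commutator G) = p * Nat.card G :=
    fun z hz => hN ▸ card_setOf_commutatorElement_mem_mul hNG (hcam z hz)
  have hKx : K x ⊆ (zpowers x ⊔ commutator G : Subgroup G) := by
    intro y hy
    by_contra hyx
    have hxy : ⁅x, y⁆ ∈ center G := by
      rw [← commutatorElement_inv]
      exact inv_mem (hNc hy)
    exact hxC (commute_of_isConj_commutatorElement hxy (hconj x hx y hyx)).1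
  have hGpos : 0 < Nat.card (commutator G) := Nat.card_pos
  obtain ⟨c, hcC, hc⟩ : ∃ c ∈ centralizer (commutator G : Set G), c ∉ commutator G := by
    by_contra! hC
    have hle := hG.card_mul_le_card_commutator_sq hp hNc hNG hN hcomm hC
    rw [mul_comm, ← hKcard x hx] at hle
    have hlt : (commutator G : Set G).ncard < (K x).ncard := by
      refine Set.ncard_lt_ncard ⟨fun u hu => hcomm u hu x, fun h => hx (h ?_)⟩ (Set.toFinite _)
      simp [K]
    exact absurd (Nat.le_of_mul_le_mul_right hle hGpos) (not_le.mpr hlt)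
  obtain ⟨z, hz, hz1⟩ : ∃ z ∈ N, z ≠ 1 := by
    have : Nontrivial N := Finite.one_lt_card_iff_nontrivial.mp (hN ▸ hp.one_lt)
    exact exists_ne_one_of_nontrivial N
  obtain ⟨y, rfl⟩ := hcam c hc z (hNG hz)
  have hcz : zpowers c ⊔ commutator G ≤ centralizer {c} :=
    sup_le (zpowers_le.mpr (mem_centralizer_singleton_iff.mpr rfl)) fun u hu =>
      mem_centralizer_singleton_iff.mpr (mem_centralizer_iff.mp hcC u hu)
  have hlt : ((zpowers c ⊔ commutator G : Subgroup G) : Set G).ncard < (K c).ncard := by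
    refine Set.ncard_lt_ncard ⟨fun u hu => ?_, fun h => hz1 ?_⟩ (Set.toFinite _)
    · have := commutatorElement_eq_one_iff_mul_comm.mpr (mem_centralizer_singleton_iff.mp (hcz hu))
      simp [K, this]
    · exact commutatorElement_eq_one_iff_mul_comm.mpr
        (mem_centralizer_singleton_iff.mp (hcz (h hz)))
  have hle := Set.ncard_le_ncard hKx (Set.toFinite _)
  have hKeq : (K x).ncard = (K c).ncard :=
    Nat.eq_of_mul_eq_mul_right hGpos ((hKcard x hx).trans (hKcard c hc).symm)
  have hcl : commutator G < zpowers c ⊔ commutator G :=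
    lt_of_le_of_ne le_sup_right fun e => hc (e ▸ mem_sup_left (mem_zpowers c))
  have h1 := hG.mul_card_le_card_of_lt hp hcl
  have h2 := card_zpowers_sup_le hp.pos (hpow x)
  have h3 : ∀ H : Subgroup G, (H : Set G).ncard = Nat.card H := fun _ => rfl
  rw [h3] at hlt hle
  omega

/-- A finite Camina `p`-group with elementary abelian abelianization in which commutators of
independent elements are, up to conjugacy, unaffected by changing their entries modulo `γ₂(G)`
has nilpotency class at most two. -/
theorem IsPGroup.commutator_le_center (hp : p.Prime) : ∀ (k : ℕ) {G : Type*} [Group G] [Finite G],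
    Nat.card G = k → IsPGroup p G → (∀ x : G, x ^ p ∈ commutator G) →
    (∀ x ∉ commutator G, ∀ u ∈ commutator G, ∃ y : G, ⁅y, x⁆ = u) →
    (∀ x ∉ commutator G, ∀ y ∉ zpowers x ⊔ commutator G,
      ∀ a ∈ commutator G, ∀ b ∈ commutator G, IsConj ⁅x, y⁆ ⁅x * a, y * b⁆) →
    commutator G ≤ center G := by
  have := Fact.mk hp
  intro k
  induction k using Nat.strong_induction_on with
  | _ k ih =>
  intro G _ _ hk hG hpow hcam hconj
  rcases eq_or_ne (commutator G) ⊥ with h0 | h0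
  · exact h0 ▸ bot_le
  obtain ⟨u, hu, hu1⟩ := (bot_or_exists_ne_one (commutator G)).resolve_left h0
  have : Nontrivial G := ⟨u, 1, hu1⟩
  have hcen : center G ≤ commutator G := by
    intro z hz
    by_contra hzG
    obtain ⟨y, hy⟩ := hcam z hzG u hu
    rw [commutatorElement_eq_one_iff_mul_comm.mpr (mem_center_iff.mp hz y)] at hy
    exact hu1 hy.symm
  have : Nontrivial (center G) := hG.center_nontrivial
  obtain ⟨z, hz⟩ := exists_prime_orderOf_dvd_card' (G := center G) p
    (((hG.to_subgroup _).card_eq_or_dvd).resolve_left Finite.one_lt_card.ne')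
  set N := zpowers (z : G) with hNdef
  have hNc : N ≤ center G := zpowers_le.mpr z.2
  have hN : Nat.card N = p := by rw [Nat.card_zpowers, orderOf_coe, hz]
  have : N.Normal := ⟨fun n hn g => by
    rwa [mem_center_iff.mp (hNc hn) g, mul_inv_cancel_right]⟩
  have hNG := hNc.trans hcen
  have hmap : commutator (G ⧸ N) = (commutator G).map (QuotientGroup.mk' N) := by
    rw [_root_.commutator_def, _root_.commutator_def, map_commutator, map_top_of_surjective _
      (QuotientGroup.mk'_surjective N)]
  have hmem : ∀ x : G, x ∈ commutator G → (x : G ⧸ N) ∈ commutator (G ⧸ N) :=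
    fun x hx => hmap ▸ mem_map_of_mem _ hx
  have hlift : ∀ a ∈ commutator (G ⧸ N), ∃ b ∈ commutator G, (b : G ⧸ N) = a := by
    intro a ha
    rw [hmap] at ha
    exact ha
  refine hG.commutator_le_center_of_card_eq hp hpow hcam hconj hNc hNG hN fun u hu g => ?_
  have hquot : commutator (G ⧸ N) ≤ center (G ⧸ N) := by
    refine ih (Nat.card (G ⧸ N)) ?_ rfl (hG.to_quotient N) ?_ ?_ ?_
    · rw [← hk, N.card_eq_card_quotient_mul_card_subgroup, hN]
      exact lt_mul_of_one_lt_right Nat.card_pos hp.one_lt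
    · rintro ⟨x⟩
      exact hmem _ (hpow x)
    · rintro ⟨x⟩ hx u hu
      obtain ⟨u, hu', rfl⟩ := hlift u hu
      obtain ⟨y, rfl⟩ := hcam x (fun h => hx (hmem x h)) u hu'
      exact ⟨y, rfl⟩
    · rintro ⟨x⟩ hx ⟨y⟩ hy a ha b hb
      obtain ⟨a, ha', rfl⟩ := hlift a ha
      obtain ⟨b, hb', rfl⟩ := hlift b hb
      refine (QuotientGroup.mk' N).map_isConj
        (hconj x (fun h => hx (hmem x h)) y (fun h => hy ?_) a ha' b hb')
      have := mem_map_of_mem (QuotientGroup.mk' N) h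
      rwa [Subgroup.map_sup, MonoidHom.map_zpowers, ← hmap] at this
  rw [← QuotientGroup.eq_one_iff]
  exact commutatorElement_eq_one_iff_mul_comm.mpr
    (mem_center_iff.mp (hquot (hmem u hu)) (g : G ⧸ N)).symm

end CaminaCore

section ClassPreserving

variable {G : Type*} [Group G]

theorem IsConj.inv_mul_mem_commutator {x y : G} (h : IsConj x y) : x⁻¹ * y ∈ commutator G := by
  obtain ⟨c, rfl⟩ := isConj_iff.mp h
  have : x⁻¹ * (c * x * c⁻¹) = ⁅x⁻¹, c⁆ := by rw [commutatorElement_def]; group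
  rw [this]
  exact commutator_mem_commutator (mem_top _) (mem_top _)

theorem card_isConj_le_card_commutator [Finite G] (x : G) :
    Nat.card {y : G // IsConj x y} ≤ Nat.card (commutator G) :=
  Nat.card_le_card_of_injective
    (fun y => (⟨x⁻¹ * y.1, y.2.inv_mul_mem_commutator⟩ : commutator G))
    fun _ _ h => Subtype.ext (mul_left_cancel (congrArg Subtype.val h))

theorem eq_of_eqOn_of_closure_eq_top {U : Set G} (hU : closure U = ⊤)
    {α β : classPreservingAuts G} (h : ∀ u ∈ U, α.1 u = β.1 u) : α = β :=
  Subtype.ext (MulEquiv.toMonoidHom_injective (MonoidHom.eq_of_eqOn_dense hU h))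

theorem card_classPreservingAuts_le_prod [Finite G] {S : Finset G}
    (hgen : closure (S : Set G) = ⊤) :
    Nat.card (classPreservingAuts G) ≤ ∏ x ∈ S, Nat.card {y : G // IsConj x y} := by
  rw [← Finset.prod_coe_sort, ← Nat.card_pi]
  refine Nat.card_le_card_of_injective
    (fun α (x : S) => (⟨α.1 x, α.2 x⟩ : {y : G // IsConj (x : G) y})) fun α β h => ?_
  exact eq_of_eqOn_of_closure_eq_top hgen fun u hu => congrArg Subtype.val (congrFun h ⟨u, hu⟩)

theorem prod_card_isConj_le [Finite G] (S : Finset G) :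
    ∏ x ∈ S, Nat.card {y : G // IsConj x y} ≤ Nat.card (commutator G) ^ S.card :=
  Finset.prod_le_pow_card _ _ _ fun x _ => card_isConj_le_card_commutator x

/-- The displacements `u⁻¹ * α u` of a class preserving automorphism on a set `U`. -/
def classPreservingAuts.displacement (U : Finset G) (α : classPreservingAuts G) :
    U → commutator G :=
  fun u => ⟨(u : G)⁻¹ * α.1 u, (α.2 u).inv_mul_mem_commutator⟩

theorem classPreservingAuts.displacement_injective {U : Finset G}
    (hU : closure (U : Set G) = ⊤) :
    Function.Injective (classPreservingAuts.displacement U) := fun _ _ h =>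
  eq_of_eqOn_of_closure_eq_top hU fun u hu =>
    mul_left_cancel (congrArg Subtype.val (congrFun h ⟨u, hu⟩))

theorem card_eq_of_pow_le_card_classPreservingAuts [Finite G] {k : ℕ}
    (hm : 1 < Nat.card (commutator G))
    (hk : Nat.card (commutator G) ^ k ≤ Nat.card (classPreservingAuts G))
    {U : Finset G} (hU : closure (U : Set G) = ⊤) (hUk : U.card ≤ k) : U.card = k := by
  refine le_antisymm hUk ((Nat.pow_le_pow_iff_right hm).mp (hk.trans ?_))
  exact (card_classPreservingAuts_le_prod hU).trans (prod_card_isConj_le U)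

/-- When `Aut_c(G)` is as large as possible, a class preserving automorphism may move the
elements of a small generating set independently within their cosets of `γ₂(G)`. -/
theorem exists_classPreservingAut_apply_eq [Finite G] {k : ℕ}
    (hm : 1 < Nat.card (commutator G))
    (hk : Nat.card (commutator G) ^ k ≤ Nat.card (classPreservingAuts G))
    {U : Finset G} (hU : closure (U : Set G) = ⊤) (hUk : U.card ≤ k)
    (f : G → G) (hf : ∀ u ∈ U, f u ∈ commutator G) :
    ∃ α ∈ classPreservingAuts G, ∀ u ∈ U, α u = u * f u := by
  have hcard : Nat.card (U → commutator G) ≤ Nat.card (classPreservingAuts G) := by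
    rw [Nat.card_fun, Nat.card_eq_fintype_card (α := U), Fintype.card_coe]
    exact (Nat.pow_le_pow_right hm.le hUk).trans hk
  have hbij := (classPreservingAuts.displacement_injective hU).bijective_of_nat_card_le hcard
  obtain ⟨α, hα⟩ := hbij.2 fun u => ⟨f u, hf u u.2⟩
  refine ⟨α.1, α.2, fun u hu => ?_⟩
  have := congrArg Subtype.val (congrFun hα ⟨u, hu⟩)
  exact inv_mul_eq_iff_eq_mul.mp this

theorem IsPGroup.exists_generating_superset [Finite G] {p k j : ℕ} (hp : p.Prime)
    (hG : IsPGroup p G) (hk : p ^ k * Nat.card (commutator G) = Nat.card G) {T : Finset G}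
    (hT : p ^ j * Nat.card (commutator G) ≤
      Nat.card (closure (T : Set G) ⊔ commutator G : Subgroup G)) :
    ∃ U : Finset G, T ⊆ U ∧ closure (U : Set G) = ⊤ ∧ U.card + j ≤ T.card + k := by
  classical
  obtain ⟨V, hV, hc⟩ := hG.exists_finset_closure_sup_eq hp
    (le_top : closure (T : Set G) ⊔ commutator G ≤ ⊤)
  refine ⟨T ∪ V, Finset.subset_union_left, hG.eq_top_of_sup_commutator hp ?_, ?_⟩
  · rw [Finset.coe_union, Subgroup.closure_union, sup_comm (closure (T : Set G)), sup_assoc, hV]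
  · have h : p ^ (V.card + j) * Nat.card (commutator G) ≤ p ^ k * Nat.card (commutator G) := by
      rw [hk, pow_add, mul_assoc, ← card_top (G := G)]
      exact (Nat.mul_le_mul_left _ hT).trans hc
    have := (Nat.pow_le_pow_iff_right hp.one_lt).mp (Nat.le_of_mul_le_mul_right h Nat.card_pos)
    have := Finset.card_union_le T V
    omega

theorem commutatorElement_pow_left {x y : G} (h : ⁅y, x⁆ ∈ center G) (n : ℕ) :
    ⁅y ^ n, x⁆ = ⁅y, x⁆ ^ n := by
  induction n with
  | zero => simp
  | succ n ih =>
    rw [pow_succ, commutatorElement_mul_left_eq_conj_mul, ih, mem_center_iff.mp h,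
      mul_inv_cancel_right, pow_succ']

theorem card_addMonoidHom_of_module_zmod {p : ℕ} (hp : p.Prime) {V W : Type*} [AddCommGroup V]
    [AddCommGroup W] [Module (ZMod p) V] [Module (ZMod p) W] [Finite V] [Finite W]
    {k m : ℕ} (hk : Nat.card V = p ^ k) (hm : Nat.card W = p ^ m) :
    Nat.card (V →+ W) = p ^ (m * k) := by
  have := Fact.mk hp
  have h1 : Nat.card V = Nat.card (ZMod p) ^ Module.finrank (ZMod p) V :=
    Module.natCard_eq_pow_finrank
  have h2 : Nat.card W = Nat.card (ZMod p) ^ Module.finrank (ZMod p) W :=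
    Module.natCard_eq_pow_finrank
  have h3 : Nat.card (V →ₗ[ZMod p] W) =
      Nat.card (ZMod p) ^ Module.finrank (ZMod p) (V →ₗ[ZMod p] W) :=
    Module.natCard_eq_pow_finrank
  rw [Nat.card_zmod] at h1 h2 h3
  have e1 := Nat.pow_right_injective hp.two_le (hk.symm.trans h1)
  have e2 := Nat.pow_right_injective hp.two_le (hm.symm.trans h2)
  rw [Module.finrank_linearMap, ← e1, ← e2, mul_comm] at h3
  rw [← h3]
  exact Nat.card_congr (AddMonoidHom.toZModLinearMapEquiv p).toEquiv

theorem card_monoidHom_of_pow_eq_one {p : ℕ} (hp : p.Prime) {A B : Type*} [CommGroup A]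
    [CommGroup B] [Finite A] [Finite B] (hA : ∀ a : A, a ^ p = 1) (hB : ∀ b : B, b ^ p = 1)
    {k m : ℕ} (hk : Nat.card A = p ^ k) (hm : Nat.card B = p ^ m) :
    Nat.card (A →* B) = p ^ (m * k) := by
  let _ : Module (ZMod p) (Additive A) := AddCommGroup.zmodModule (n := p) hA
  let _ : Module (ZMod p) (Additive B) := AddCommGroup.zmodModule (n := p) hB
  rw [Nat.card_congr MonoidHom.toAdditive]
  exact card_addMonoidHom_of_module_zmod hp (V := Additive A) (W := Additive B) hk hm

/-- The automorphism `x ↦ x * f x` attached to a homomorphism into the center that is trivial on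
the center. -/
def centralAut (f : G →* center G) (hf : ∀ z ∈ center G, f z = 1) : MulAut G where
  toFun x := x * f x
  invFun x := x * (f x)⁻¹
  left_inv x := by simp [hf _ (f x).2]
  right_inv x := by simp [hf _ (inv_mem (f x).2)]
  map_mul' x y := by
    have := mem_center_iff.mp (f x).2 y
    simp only [map_mul, Subgroup.coe_mul]
    rw [mul_assoc, ← mul_assoc y, this]
    group

open scoped IsMulCommutative in
theorem card_classPreservingAuts_of_camina_special [Finite G] {p k m : ℕ} (hp : p.Prime)
    (hk : p ^ k * Nat.card (commutator G) = Nat.card G) (hm : Nat.card (commutator G) = p ^ m)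
    (hZ : center G = commutator G) (hpow : ∀ g ∈ center G, g ^ p = 1)
    (hcam : ∀ x : G, x ∉ commutator G → ∀ u ∈ commutator G, IsConj x (x * u)) :
    p ^ (m * k) ≤ Nat.card (classPreservingAuts G) := by
  have hxp : ∀ x : G, x ^ p ∈ commutator G := by
    intro x
    rw [← hZ, mem_center_iff]
    intro g
    have hc : ⁅x, g⁆ ∈ center G := hZ ▸ commutator_mem_commutator (mem_top x) (mem_top g)
    have := commutatorElement_pow_left hc p
    rw [hpow _ hc, commutatorElement_eq_one_iff_mul_comm] at this
    exact this.symm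
  have hker : ∀ (f : G →* center G), ∀ z ∈ center G, f z = 1 := by
    intro f z hz
    rw [hZ] at hz
    exact Abelianization.commutator_subset_ker f hz
  have hA : ∀ a : Abelianization G, a ^ p = 1 := by
    rintro ⟨a⟩
    exact (QuotientGroup.eq_one_iff _).mpr (hxp a)
  have hAcard : Nat.card (Abelianization G) = p ^ k := by
    refine Nat.eq_of_mul_eq_mul_right (Nat.card_pos (α := commutator G)) ?_
    rw [hk]
    exact (commutator G).card_eq_card_quotient_mul_card_subgroup.symm
  rw [← card_monoidHom_of_pow_eq_one hp hA (B := center G)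
      (fun b => Subtype.ext (by simpa using hpow b b.2)) hAcard (by rw [hZ, hm]),
    ← Nat.card_congr (Abelianization.lift (G := G) (A := center G))]
  refine Nat.card_le_card_of_injective (fun f => (⟨centralAut f (hker f), fun x => ?_⟩ :
    classPreservingAuts G)) fun f g h => ?_
  · change IsConj x (x * f x)
    by_cases hx : x ∈ commutator G
    · rw [hker f x (hZ ▸ hx), OneMemClass.coe_one, mul_one]
    · exact hcam x hx _ (hZ ▸ (f x).2)
  · ext x
    have := DFunLike.congr_fun (congrArg Subtype.val h) x
    exact mul_left_cancel this

end ClassPreserving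

section Equality

variable {p : ℕ} {G : Type*} [Group G] [Finite G] {k : ℕ}

theorem exists_classPreservingAut_apply_eq_of_notMem (hp : p.Prime) (hG : IsPGroup p G)
    (hk : p ^ k * Nat.card (commutator G) = Nat.card G) (hm : 1 < Nat.card (commutator G))
    (hA : Nat.card (commutator G) ^ k ≤ Nat.card (classPreservingAuts G))
    {x : G} (hx : x ∉ commutator G) {a : G} (ha : a ∈ commutator G) :
    ∃ U : Finset G, x ∈ U ∧ U.card = k ∧ closure (U : Set G) = ⊤ ∧
      ∃ α ∈ classPreservingAuts G, α x = x * a := by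
  have hlt : commutator G < zpowers x ⊔ commutator G :=
    lt_of_le_of_ne le_sup_right fun e => hx (e ▸ mem_sup_left (mem_zpowers x))
  obtain ⟨U, hTU, hU, hc⟩ := hG.exists_generating_superset hp hk (T := {x}) (j := 1) (by
    rw [Finset.coe_singleton, ← zpowers_eq_closure, pow_one]
    exact hG.mul_card_le_card_of_lt hp hlt)
  rw [Finset.card_singleton] at hc
  have hUk : U.card ≤ k := by omega
  have hxU : x ∈ U := hTU (Finset.mem_singleton_self x)
  obtain ⟨α, hα, h⟩ := exists_classPreservingAut_apply_eq hm hA hU hUk (fun _ => a) fun _ _ => ha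
  exact ⟨U, hxU, card_eq_of_pow_le_card_classPreservingAuts hm hA hU hUk, hU, α, hα, h x hxU⟩

theorem exists_classPreservingAut_apply_pair_eq (hp : p.Prime) (hG : IsPGroup p G)
    (hk : p ^ k * Nat.card (commutator G) = Nat.card G) (hm : 1 < Nat.card (commutator G))
    (hA : Nat.card (commutator G) ^ k ≤ Nat.card (classPreservingAuts G))
    {x y : G} (hx : x ∉ commutator G) (hy : y ∉ zpowers x ⊔ commutator G) {a b : G}
    (ha : a ∈ commutator G) (hb : b ∈ commutator G) :
    ∃ α ∈ classPreservingAuts G, α x = x * a ∧ α y = y * b := by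
  classical
  have hlt : commutator G < zpowers x ⊔ commutator G :=
    lt_of_le_of_ne le_sup_right fun e => hx (e ▸ mem_sup_left (mem_zpowers x))
  have hlt' : zpowers x ⊔ commutator G < zpowers y ⊔ (zpowers x ⊔ commutator G) :=
    lt_of_le_of_ne le_sup_right fun e => hy (e ▸ mem_sup_left (mem_zpowers y))
  have hyx : y ≠ x := by
    rintro rfl
    exact hy (mem_sup_left (mem_zpowers y))
  obtain ⟨U, hTU, hU, hc⟩ := hG.exists_generating_superset hp hk (T := {y, x}) (j := 2) (by
    rw [Finset.coe_pair, Set.insert_eq, Subgroup.closure_union, ← zpowers_eq_closure,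
      ← zpowers_eq_closure, sup_assoc, pow_two, mul_assoc]
    exact (Nat.mul_le_mul_left p (hG.mul_card_le_card_of_lt hp hlt)).trans
      (hG.mul_card_le_card_of_lt hp hlt'))
  rw [Finset.card_pair hyx] at hc
  obtain ⟨α, hα, h⟩ := exists_classPreservingAut_apply_eq hm hA hU (by omega)
    (fun u => if u = x then a else b) fun u _ => by split_ifs <;> assumption
  refine ⟨α, hα, ?_, ?_⟩
  · simpa using h x (hTU (by simp))
  · simpa [hyx] using h y (hTU (by simp))

theorem pow_mem_commutator_of_card_classPreservingAuts (hp : p.Prime) (hG : IsPGroup p G)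
    (hk : p ^ k * Nat.card (commutator G) = Nat.card G) (hm : 1 < Nat.card (commutator G))
    (hA : Nat.card (commutator G) ^ k ≤ Nat.card (classPreservingAuts G)) (x : G) :
    x ^ p ∈ commutator G := by
  have := Fact.mk hp
  let X := zpowers x ⊔ commutator G
  have hxX : x ∈ X := mem_sup_left (mem_zpowers x)
  let N := (commutator G).subgroupOf X
  obtain ⟨i, hi⟩ := (hG.to_subgroup X).index N
  have hcard : p ^ i * Nat.card (commutator G) = Nat.card X := by
    rw [← hi, ← N.index_mul_card, Nat.card_congr (subgroupOfEquivOfLe le_sup_right).toEquiv]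
  obtain ⟨U, -, hU, hc⟩ := hG.exists_generating_superset hp hk (T := {x}) (j := i) (by
    rw [Finset.coe_singleton, ← zpowers_eq_closure, hcard])
  rw [Finset.card_singleton] at hc
  have hi1 : i ≤ 1 := by
    by_contra! h
    have := card_eq_of_pow_le_card_classPreservingAuts hm hA hU (by omega)
    omega
  have hpow : x ^ p ^ i ∈ commutator G := by
    have := N.pow_index_mem (⟨x, hxX⟩ : X)
    rw [hi] at this
    exact this
  interval_cases i
  · exact pow_mem (by simpa using hpow) p
  · simpa using hpow

/-- If `Aut_c(G)` has the maximal possible order and `G` is non-abelian, then `G` is a Camina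
special `p`-group. -/
theorem camina_special_of_card_classPreservingAuts (hp : p.Prime) (hG : IsPGroup p G)
    (hk : p ^ k * Nat.card (commutator G) = Nat.card G) (hm : 1 < Nat.card (commutator G))
    (hA : Nat.card (commutator G) ^ k ≤ Nat.card (classPreservingAuts G)) :
    center G = commutator G ∧ commutator G = frattini G ∧ (∀ g ∈ center G, g ^ p = 1) ∧
      ∀ x : G, x ∉ commutator G → ∀ u ∈ commutator G, IsConj x (x * u) := by
  classical
  have hcam : ∀ x : G, x ∉ commutator G → ∀ u ∈ commutator G, IsConj x (x * u) := by
    intro x hx u hu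
    obtain ⟨-, -, -, -, α, hα, h⟩ :=
      exists_classPreservingAut_apply_eq_of_notMem hp hG hk hm hA hx hu
    exact h ▸ hα x
  have hcam' : ∀ x ∉ commutator G, ∀ u ∈ commutator G, ∃ y : G, ⁅y, x⁆ = u := by
    intro x hx u hu
    obtain ⟨y, hy⟩ := isConj_iff.mp
      (hcam x hx _ ((inferInstance : (commutator G).Normal).conj_mem u hu x⁻¹))
    refine ⟨y, ?_⟩
    rw [commutatorElement_def, hy]
    group
  have hpow := pow_mem_commutator_of_card_classPreservingAuts hp hG hk hm hA
  have hle : commutator G ≤ center G := by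
    refine IsPGroup.commutator_le_center hp _ rfl hG hpow hcam' fun x hx y hy a ha b hb => ?_
    obtain ⟨α, hα, hαx, hαy⟩ :=
      exists_classPreservingAut_apply_pair_eq hp hG hk hm hA hx hy ha hb
    have := hα ⁅x, y⁆
    rwa [map_commutatorElement, hαx, hαy] at this
  have : Nontrivial (commutator G) := Finite.one_lt_card_iff_nontrivial.mp hm
  obtain ⟨u, hu, hu1⟩ := exists_ne_one_of_nontrivial (commutator G)
  have hZ : center G = commutator G := by
    refine le_antisymm (fun z hz => ?_) hle
    by_contra hzG
    obtain ⟨y, hy⟩ := hcam' z hzG u hu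
    rw [commutatorElement_eq_one_iff_mul_comm.mpr (mem_center_iff.mp hz y)] at hy
    exact hu1 hy.symm
  refine ⟨hZ, le_antisymm (hG.commutator_le_frattini hp) fun x hx => ?_, fun g hg => ?_, hcam⟩
  · by_contra hxG
    obtain ⟨U, hxU, hUk, hU, -⟩ :=
      exists_classPreservingAut_apply_eq_of_notMem hp hG hk hm hA hxG (one_mem _)
    have hgen : closure ((U.erase x : Finset G) : Set G) = ⊤ := by
      refine frattini_nongenerating (eq_top_iff.mpr ?_)
      rw [← hU, closure_le]
      intro y hy
      by_cases hyx : y = x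
      · exact mem_sup_right (hyx ▸ hx)
      · exact mem_sup_left (subset_closure (by simpa [hyx] using hy))
    have h1 := Finset.card_erase_lt_of_mem hxU
    have h2 := card_eq_of_pow_le_card_classPreservingAuts hm hA hgen (by omega)
    omega
  · obtain ⟨x, hx⟩ : ∃ x, x ∉ commutator G := by
      by_contra! h
      have htop : center G = ⊤ := hZ.trans (eq_top_iff.mpr fun x _ => h x)
      rw [← commutator_eq_bot_iff_center_eq_top] at htop
      rw [htop] at hu
      exact hu1 (mem_bot.mp hu)
    obtain ⟨y, rfl⟩ := hcam' x hx g (hZ ▸ hg)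
    rw [← commutatorElement_pow_left hg, commutatorElement_eq_one_iff_mul_comm]
    exact (mem_center_iff.mp (hle (hpow y)) x).symm

end Equality

end

/-- Let `G` be a finite `p`-group of order `pⁿ` with `|γ₂(G)| = p^m` and let
`{x₁, …, x_d}` be any minimal generating set of `G`.  Then
`|Aut_c(G)| ≤ ∏ᵢ |xᵢ^G| ≤ p^{md} ≤ p^{m(n-m)}`, and
`|Aut_c(G)| = p^{m(n-m)}` if and only if `G` is abelian or a non-abelian
Camina special `p`-group (special: `Z(G) = γ₂(G) = Φ(G)` elementary abelian). -/
theorem autc_card_bounds_and_equality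
    {p : ℕ} (hp : p.Prime) {G : Type*} [Group G] [Finite G]
    {n m : ℕ} (hcard : Nat.card G = p ^ n)
    (hcomm : Nat.card (commutator G) = p ^ m)
    (S : Finset G) (hgen : Subgroup.closure (S : Set G) = ⊤)
    (hmin : ∀ T : Finset G, T ⊂ S → Subgroup.closure (T : Set G) ≠ ⊤) :
    Nat.card (classPreservingAuts G) ≤ ∏ x ∈ S, Nat.card {y : G // IsConj x y} ∧
    (∏ x ∈ S, Nat.card {y : G // IsConj x y}) ≤ p ^ (m * S.card) ∧
    p ^ (m * S.card) ≤ p ^ (m * (n - m)) ∧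
    (Nat.card (classPreservingAuts G) = p ^ (m * (n - m)) ↔
      ((∀ a b : G, a * b = b * a) ∨
       (¬ (∀ a b : G, a * b = b * a) ∧
        Subgroup.center G = commutator G ∧ commutator G = frattini G ∧
        (∀ g ∈ Subgroup.center G, g ^ p = 1) ∧
        (∀ x : G, x ∉ commutator G → ∀ u ∈ commutator G, IsConj x (x * u))))) := by
  have hG : IsPGroup p G := IsPGroup.of_card hcard
  have hmn : m ≤ n := by
    rw [← Nat.pow_le_pow_iff_right hp.one_lt, ← hcard, ← hcomm]
    exact Subgroup.card_le_card_group _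
  have hk : p ^ (n - m) * Nat.card (commutator G) = Nat.card G := by
    rw [hcomm, hcard, ← pow_add, Nat.sub_add_cancel hmn]
  have hSk : S.card ≤ n - m := by
    have := hG.pow_card_mul_card_commutator_le hp hgen hmin
    rw [← hk] at this
    exact (Nat.pow_le_pow_iff_right hp.one_lt).mp (Nat.le_of_mul_le_mul_right this Nat.card_pos)
  have h1 := card_classPreservingAuts_le_prod hgen
  have h2 : ∏ x ∈ S, Nat.card {y : G // IsConj x y} ≤ p ^ (m * S.card) := by
    rw [pow_mul, ← hcomm]
    exact prod_card_isConj_le S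
  have h3 : p ^ (m * S.card) ≤ p ^ (m * (n - m)) :=
    Nat.pow_le_pow_right hp.pos (Nat.mul_le_mul_left m hSk)
  refine ⟨h1, h2, h3, fun hA => ?_, ?_⟩
  · refine or_iff_not_imp_left.mpr fun hab => ⟨hab, ?_⟩
    refine camina_special_of_card_classPreservingAuts hp hG hk ?_ (by rw [hA, hcomm, pow_mul])
    by_contra! hle
    have hbot := Subgroup.eq_bot_of_card_le _ hle
    rw [commutator_eq_bot_iff] at hbot
    exact hab fun a b => hbot.is_comm.comm a b
  · rintro (hab | ⟨-, hZ, -, hpow, hcam⟩)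
    · have hbot : commutator G = ⊥ := (commutator_eq_bot_iff G).mpr ⟨⟨hab⟩⟩
      have hm : m = 0 := by
        rw [hbot, Subgroup.card_bot] at hcomm
        exact (Nat.pow_eq_one.mp hcomm.symm).resolve_left hp.one_lt.ne'
      subst hm
      refine le_antisymm ((h1.trans h2).trans h3) ?_
      rw [zero_mul, pow_zero]
      exact Nat.card_pos
    · exact le_antisymm ((h1.trans h2).trans h3)
        (card_classPreservingAuts_of_camina_special hp hk hcomm hZ hpow hcam)
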